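/- With Ψ as above, the 4×4 matrix p = ΨΨ† satisfies p² = p and p† = p, i.e. p is a self-adjoint idempotent with entries in the subalgebra generated by z₀ = ψ₁*ψ₁+ψ₂*ψ₂−ψ₃*ψ₃−ψ₄*ψ₄, z₁ = 2(μψ₃*ψ₁+ψ₂*ψ₄), z₂ = 2(−ψ₁*ψ₄+μ̄ψ₃*ψ₂) and their adjoints. -/

import Mathlib

/-- A matrix with orthonormal columns gives a self-adjoint idempotent. -/
theorem Matrix.mul_conjTranspose_idempotent {m n A : Type*} [Fintype m] [Fintype n]
    [DecidableEq n] [Ring A] [StarRing A] (V : Matrix m n A)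
    (hV : V.conjTranspose * V = 1) :
    V * V.conjTranspose * (V * V.conjTranspose) = V * V.conjTranspose := by
  rw [Matrix.mul_assoc, ← Matrix.mul_assoc V.conjTranspose, hV, Matrix.one_mul]

theorem Complex.star_mul_self_exp_pi_I (θ : ℝ) :
    star (Complex.exp (Real.pi * Complex.I * θ)) * Complex.exp (Real.pi * Complex.I * θ) = 1 := by
  rw [Complex.star_def, ← Complex.exp_conj, ← Complex.exp_add]
  simp

set_option maxHeartbeats 1000000 in

/-- With `Ψ` as in the toric 7-sphere setup, the 4×4 matrix
`p = ΨΨ†` satisfies `p² = p` and `p† = p`, i.e. `p` is a self-adjoint idempotent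
with entries in the subalgebra generated by
`z₀ = ψ₁*ψ₁+ψ₂*ψ₂−ψ₃*ψ₃−ψ₄*ψ₄`, `z₁ = 2(μψ₃*ψ₁+ψ₂*ψ₄)`,
`z₂ = 2(−ψ₁*ψ₄+μ̄ψ₃*ψ₂)` and their adjoints. -/
theorem stmt_3 (θ : ℝ) (A : Type*) [Ring A] [Algebra ℂ A] [StarRing A]
    [StarModule ℂ A]
    (μ : ℂ) (hμ : μ = Complex.exp (Real.pi * Complex.I * θ))
    (lam' : Matrix (Fin 4) (Fin 4) ℂ)
    (hlam' : lam' = !![1, 1, star μ, μ;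
                       1, 1, μ, star μ;
                       μ, star μ, 1, 1;
                       star μ, μ, 1, 1])
    (ψ : Fin 4 → A)
    (hrel1 : ∀ a b, ψ a * ψ b = lam' a b • (ψ b * ψ a))
    (hrel2 : ∀ a b, ψ a * star (ψ b) = lam' b a • (star (ψ b) * ψ a))
    (hrel3 : ∀ a b, star (ψ a) * star (ψ b) = lam' a b • (star (ψ b) * star (ψ a)))
    (hsph : ∑ a, star (ψ a) * ψ a = 1)
    (Ψ : Matrix (Fin 4) (Fin 2) A)
    (hΨ : Ψ = Matrix.of ![![ψ 0, -star (ψ 1)],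
                          ![ψ 1, star (ψ 0)],
                          ![ψ 2, -star (ψ 3)],
                          ![ψ 3, star (ψ 2)]])
    (p : Matrix (Fin 4) (Fin 4) A) (hp : p = Ψ * Ψ.conjTranspose)
    (z₀ z₁ z₂ : A)
    (hz₀ : z₀ = star (ψ 0) * ψ 0 + star (ψ 1) * ψ 1
              - star (ψ 2) * ψ 2 - star (ψ 3) * ψ 3)
    (hz₁ : z₁ = (2 : ℂ) • (μ • (star (ψ 2) * ψ 0) + star (ψ 1) * ψ 3))
    (hz₂ : z₂ = (2 : ℂ) • (-(star (ψ 0) * ψ 3) + star μ • (star (ψ 2) * ψ 1))) :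
    p * p = p ∧ p.conjTranspose = p ∧
    ∀ i j, p i j ∈ Algebra.adjoin ℂ
      ({z₀, z₁, z₂, star z₁, star z₂} : Set A) := by
  have hμμ : starRingEnd ℂ μ * μ = 1 := hμ ▸ Complex.star_mul_self_exp_pi_I θ
  have hone : (1 : A) = star (ψ 0) * ψ 0 + star (ψ 1) * ψ 1
      + star (ψ 2) * ψ 2 + star (ψ 3) * ψ 3 := by
    rw [← hsph, Fin.sum_univ_four]
  have hnormal : ∀ a, ψ a * star (ψ a) = star (ψ a) * ψ a := fun a => by
    rw [hrel2]
    fin_cases a <;> simp [hlam']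
  have h01 : star (ψ 0) * star (ψ 1) = star (ψ 1) * star (ψ 0) := by
    simpa [hlam'] using hrel3 0 1
  have h23 : star (ψ 2) * star (ψ 3) = star (ψ 3) * star (ψ 2) := by
    simpa [hlam'] using hrel3 2 3
  have h01' : ψ 0 * ψ 1 = ψ 1 * ψ 0 := by simpa [hlam'] using hrel1 0 1
  have h23' : ψ 2 * ψ 3 = ψ 3 * ψ 2 := by simpa [hlam'] using hrel1 2 3
  have hV : Ψ.conjTranspose * Ψ = 1 := by
    ext i j
    fin_cases i <;> fin_cases j <;>
      simp [hΨ, Matrix.mul_apply, Fin.sum_univ_four, hnormal, h01, h23, h01', h23', hone]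
    all_goals abel
  have hentries : p = (2⁻¹ : ℂ) • !![1 + z₀, 0, z₁, -(star μ • star z₂);
                                     0, 1 + z₀, z₂, μ • star z₁;
                                     star z₁, star z₂, 1 - z₀, 0;
                                     -(μ • z₂), star μ • z₁, 0, 1 - z₀] := by
    have hcomm := hlam' ▸ hrel2
    rw [hp, hz₀, hz₁, hz₂, hone]
    ext i j
    fin_cases i <;> fin_cases j <;>
      simp [hΨ, Matrix.mul_apply, hcomm, star_smul] <;>
      match_scalars <;>
      first
      | ring1
      | linear_combination hμμ
      | linear_combination -hμμ
  refine ⟨hp ▸ Matrix.mul_conjTranspose_idempotent Ψ hV, ?_, fun i j => ?_⟩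
  · rw [hp, Matrix.conjTranspose_mul, Matrix.conjTranspose_conjTranspose]
  · set S := Algebra.adjoin ℂ ({z₀, z₁, z₂, star z₁, star z₂} : Set A)
    have m₀ : z₀ ∈ S := Algebra.subset_adjoin (by simp)
    have m₁ : z₁ ∈ S := Algebra.subset_adjoin (by simp)
    have m₂ : z₂ ∈ S := Algebra.subset_adjoin (by simp)
    have m₃ : star z₁ ∈ S := Algebra.subset_adjoin (by simp)
    have m₄ : star z₂ ∈ S := Algebra.subset_adjoin (by simp)
    rw [hentries, Matrix.smul_apply]
    refine S.smul_mem ?_ _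
    fin_cases i <;> fin_cases j
    all_goals first
      | exact S.zero_mem
      | exact S.add_mem S.one_mem m₀
      | exact S.sub_mem S.one_mem m₀
      | assumption
      | exact S.smul_mem ‹_› _
      | exact S.neg_mem (S.smul_mem ‹_› _)
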